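/- For all x > 0 and 0 < a < b, the integral over t in (0, ∞) of sin(a t)·cos(b t) / (t · (x² + t²)) dt equals (π / (2x²)) · e^{-b x} · sinh(a x). -/

import Mathlib

open Real MeasureTheory Filter intervalIntegral

open scoped FourierTransform

lemma integrable_exp_neg_mul_abs {k : ℝ} (hk : 0 < k) :
    Integrable fun u : ℝ => Real.exp (-k * |u|) := by
  have h1 : IntegrableOn (fun u : ℝ => Real.exp (-k * |u|)) (Set.Iic 0) :=
    (integrableOn_exp_mul_Iic hk 0).congr_fun
      (fun u hu => by simp [abs_of_nonpos (Set.mem_Iic.1 hu)]) measurableSet_Iic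
  have h2 : IntegrableOn (fun u : ℝ => Real.exp (-k * |u|)) (Set.Ioi 0) :=
    (integrableOn_exp_mul_Ioi (neg_lt_zero.2 hk) 0).congr_fun
      (fun u hu => by simp [abs_of_pos (Set.mem_Ioi.1 hu)]) measurableSet_Ioi
  rw [← integrableOn_univ, ← Set.Iic_union_Ioi (a := (0 : ℝ))]
  exact h1.union h2

lemma integrable_inv_sq_add_sq {x : ℝ} (hx : 0 < x) :
    Integrable fun t : ℝ => (x ^ 2 + t ^ 2)⁻¹ := by
  refine ((integrable_inv_one_add_sq.comp_mul_left' (inv_ne_zero hx.ne')).const_mul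
    (x ^ 2)⁻¹).congr (.of_forall fun t => ?_)
  simp only
  field_simp

lemma fourier_exp_neg_mul_abs {x : ℝ} (hx : 0 < x) :
    𝓕 (fun u : ℝ => (Real.exp (-(2 * π * x) * |u|) : ℂ)) =
      fun w : ℝ => ((x / π * (x ^ 2 + w ^ 2)⁻¹ : ℝ) : ℂ) := by
  ext w
  rw [Real.fourier_real_eq_integral_exp_smul]
  have hk : 0 < 2 * π * x := by positivity
  have hint : Integrable fun u : ℝ => Complex.exp (↑(-2 * π * u * w) * Complex.I) •
      (Real.exp (-(2 * π * x) * |u|) : ℂ) := by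
    refine (integrable_exp_neg_mul_abs hk).mono' (by fun_prop) (.of_forall fun u => ?_)
    rw [norm_smul, Complex.norm_exp_ofReal_mul_I, one_mul, Complex.norm_real, Real.norm_eq_abs,
      abs_of_pos (Real.exp_pos _)]
  have h1 : ∫ u in Set.Iic (0 : ℝ), Complex.exp (↑(-2 * π * u * w) * Complex.I) •
      (Real.exp (-(2 * π * x) * |u|) : ℂ) = 1 / (2 * π * (x - w * Complex.I)) := by
    rw [setIntegral_congr_fun (g := fun u : ℝ => Complex.exp ((2 * π * (x - w * Complex.I)) * u))
      measurableSet_Iic, integral_exp_mul_complex_Iic]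
    · simp
    · simpa using hk
    · intro u hu
      simp only [abs_of_nonpos (Set.mem_Iic.1 hu), smul_eq_mul, Complex.ofReal_exp,
        ← Complex.exp_add]
      congr 1
      push_cast
      ring
  have h2 : ∫ u in Set.Ioi (0 : ℝ), Complex.exp (↑(-2 * π * u * w) * Complex.I) •
      (Real.exp (-(2 * π * x) * |u|) : ℂ) = 1 / (2 * π * (x + w * Complex.I)) := by
    rw [setIntegral_congr_fun (g := fun u : ℝ => Complex.exp ((-(2 * π * (x + w * Complex.I))) * u))
      measurableSet_Ioi, integral_exp_mul_complex_Ioi]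
    · simp
    · simpa using hk
    · intro u hu
      simp only [abs_of_pos (Set.mem_Ioi.1 hu), smul_eq_mul, Complex.ofReal_exp,
        ← Complex.exp_add]
      congr 1
      push_cast
      ring
  rw [← intervalIntegral.integral_Iic_add_Ioi hint.integrableOn hint.integrableOn, h1, h2]
  have e1 : (x : ℂ) - w * Complex.I ≠ 0 := fun h => hx.ne' (by simpa using congrArg Complex.re h)
  have e2 : (x : ℂ) + w * Complex.I ≠ 0 := fun h => hx.ne' (by simpa using congrArg Complex.re h)
  have e3 : (x : ℂ) ^ 2 + w ^ 2 = (x - w * Complex.I) * (x + w * Complex.I) := by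
    linear_combination (w : ℂ) ^ 2 * Complex.I_sq
  have hpi : (π : ℂ) ≠ 0 := by exact_mod_cast pi_ne_zero
  push_cast
  rw [e3]
  field_simp
  ring

lemma integral_Ioi_cos_mul_inv_sq_add_sq {x : ℝ} (hx : 0 < x) (c : ℝ) :
    ∫ t in Set.Ioi (0 : ℝ), Real.cos (c * t) * (x ^ 2 + t ^ 2)⁻¹ =
      π / (2 * x) * Real.exp (-x * |c|) := by
  have hF := fourier_exp_neg_mul_abs hx
  have hinv := congrFun (Continuous.fourierInv_fourier_eq
    (f := fun u : ℝ => (Real.exp (-(2 * π * x) * |u|) : ℂ)) (by fun_prop)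
    (integrable_exp_neg_mul_abs (by positivity)).ofReal
    (by rw [hF]; exact ((integrable_inv_sq_add_sq hx).const_mul _).ofReal)) (c / (2 * π))
  rw [hF, Real.fourierInv_eq'] at hinv
  have hint : Integrable fun t : ℝ => Complex.exp (↑(2 * π * inner ℝ t (c / (2 * π))) * Complex.I) •
      ((x / π * (x ^ 2 + t ^ 2)⁻¹ : ℝ) : ℂ) := by
    refine ((integrable_inv_sq_add_sq hx).const_mul (x / π)).mono' (by fun_prop)
      (.of_forall fun u => ?_)
    rw [norm_smul, Complex.norm_exp_ofReal_mul_I, one_mul, Complex.norm_real, Real.norm_eq_abs,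
      abs_of_nonneg (by positivity)]
  have hre := congrArg Complex.re hinv
  rw [← RCLike.re_to_complex, ← integral_re hint] at hre
  have hL : ∀ t : ℝ, RCLike.re (Complex.exp (↑(2 * π * inner ℝ t (c / (2 * π))) * Complex.I) •
      ((x / π * (x ^ 2 + t ^ 2)⁻¹ : ℝ) : ℂ)) =
      x / π * (Real.cos (c * |t|) * (x ^ 2 + |t| ^ 2)⁻¹) := by
    intro t
    have : 2 * π * inner ℝ t (c / (2 * π)) = c * t := by
      rw [real_inner_eq_re_inner ℝ, RCLike.inner_apply, conj_trivial, RCLike.re_to_real]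
      field_simp
    have hc : Real.cos (c * |t|) = Real.cos (c * t) := by
      rcases abs_choice t with h | h <;> simp [h]
    rw [this, smul_eq_mul, RCLike.re_to_complex, Complex.re_mul_ofReal, Complex.exp_ofReal_mul_I_re,
      hc, sq_abs]
    ring
  simp_rw [hL] at hre
  rw [MeasureTheory.integral_const_mul,
    integral_comp_abs (f := fun t => Real.cos (c * t) * (x ^ 2 + t ^ 2)⁻¹), Complex.ofReal_re,
    abs_div, abs_of_pos (by positivity : 0 < 2 * π),
    show -(2 * π * x) * (|c| / (2 * π)) = -x * |c| by field_simp] at hre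
  rw [← hre]
  field_simp

lemma sin_mul_cos_div_eq_integral (a b : ℝ) {t : ℝ} (ht : t ≠ 0) :
    Real.sin (a * t) * Real.cos (b * t) / t =
      1 / 2 * ∫ c in (b - a)..(b + a), Real.cos (c * t) := by
  rw [intervalIntegral.integral_comp_mul_right _ ht, integral_cos, add_mul, sub_mul, Real.sin_add,
    Real.sin_sub, smul_eq_mul]
  field_simp
  ring

theorem sin_cos_over_t_integral (a b x : ℝ) (hx : 0 < x) (ha : 0 < a) (hab : a < b) :
    Tendsto (fun R : ℝ =>
        ∫ t in (0:ℝ)..R, Real.sin (a * t) * Real.cos (b * t) / (t * (x ^ 2 + t ^ 2)))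
      atTop (nhds ((Real.pi / (2 * x ^ 2)) * Real.exp (-b * x) * Real.sinh (a * x))) := by
  have hint : Integrable (Function.uncurry fun c t : ℝ => Real.cos (c * t) * (x ^ 2 + t ^ 2)⁻¹)
      ((volume.restrict (Set.uIoc (b - a) (b + a))).prod (volume.restrict (Set.Ioi 0))) := by
    have : IsFiniteMeasure (volume.restrict (Set.uIoc (b - a) (b + a))) := by
      rw [Set.uIoc]
      infer_instance
    refine ((integrable_inv_sq_add_sq hx).restrict.comp_snd _).mono' ?_ (.of_forall fun p => ?_)
    · exact Measurable.aestronglyMeasurable (by unfold Function.uncurry; fun_prop)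
    · simp only [Function.uncurry]
      rw [norm_mul, Real.norm_eq_abs, Real.norm_eq_abs,
        abs_of_nonneg (by positivity : 0 ≤ (x ^ 2 + p.2 ^ 2)⁻¹)]
      exact mul_le_of_le_one_left (by positivity) (Real.abs_cos_le_one _)
  have heq : Set.EqOn (fun t : ℝ => 1 / 2 * ∫ c in (b - a)..(b + a),
        Real.cos (c * t) * (x ^ 2 + t ^ 2)⁻¹)
      (fun t : ℝ => Real.sin (a * t) * Real.cos (b * t) / (t * (x ^ 2 + t ^ 2)))
      (Set.Ioi 0) := by
    intro t ht
    simp only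
    rw [intervalIntegral.integral_mul_const, ← mul_assoc,
      ← sin_mul_cos_div_eq_integral a b (ne_of_gt ht), div_mul_eq_div_div, div_eq_mul_inv _ (x ^ 2 + t ^ 2)]
  have hI : IntegrableOn (fun t : ℝ => Real.sin (a * t) * Real.cos (b * t) / (t * (x ^ 2 + t ^ 2)))
      (Set.Ioi 0) := by
    refine IntegrableOn.congr_fun ?_ heq measurableSet_Ioi
    simp_rw [intervalIntegral.intervalIntegral_eq_integral_uIoc]
    exact (hint.integral_prod_right.smul (if b - a ≤ b + a then (1 : ℝ) else -1)).const_mul (1 / 2)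
  have hval : ∫ t in Set.Ioi (0 : ℝ), Real.sin (a * t) * Real.cos (b * t) / (t * (x ^ 2 + t ^ 2)) =
      (Real.pi / (2 * x ^ 2)) * Real.exp (-b * x) * Real.sinh (a * x) := by
    rw [← setIntegral_congr_fun measurableSet_Ioi heq, MeasureTheory.integral_const_mul,
      ← intervalIntegral_integral_swap hint]
    simp_rw [integral_Ioi_cos_mul_inv_sq_add_sq hx]
    rw [intervalIntegral.integral_congr (g := fun c => π / (2 * x) * Real.exp (-x * c)),
      intervalIntegral.integral_const_mul, intervalIntegral.integral_comp_mul_left _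
      (neg_ne_zero.2 hx.ne'), integral_exp, Real.sinh_eq,
      show -x * (b + a) = -b * x + -(a * x) by ring, show -x * (b - a) = -b * x + a * x by ring,
      Real.exp_add, Real.exp_add, smul_eq_mul]
    · field_simp
      ring
    · intro c hc
      rw [Set.uIcc_of_le (by linarith)] at hc
      simp only [abs_of_nonneg (show 0 ≤ c by linarith [hc.1])]
  rw [← hval]
  exact intervalIntegral_tendsto_integral_Ioi 0 hI tendsto_id
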